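/- arXiv:2405.09400 — 2 statements merged into one kernel-verified Lean document; each statement's English description precedes it below -/
import Mathlib

section
/- Let π* ∈ Π(μ,ν) be a coupling of the form π* = exp((α*(x)+β*(y)−c(x,y))/ε)·(μ⊗ν) for some α* ∈ L^∞(X,μ) and β* ∈ L^∞(Y,ν). Then π* is optimal for the entropic optimal transport problem, i.e. ⟨c,π*⟩ + ε·KL(π*|μ⊗ν) ≤ ⟨c,π⟩ + ε·KL(π|μ⊗ν) for every π ∈ Π(μ,ν). -/
open MeasureTheory Filter Topology
open scoped ENNReal

noncomputable section

/-- `π` is a coupling (transport plan) between `μ` and `ν`. -/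
def IsCoupling {X Y : Type*} [MeasurableSpace X] [MeasurableSpace Y]
    (μ : Measure X) (ν : Measure Y) (π : Measure (X × Y)) : Prop :=
  π.map Prod.fst = μ ∧ π.map Prod.snd = ν

/-- `φ(s) = s·log s − s + 1`; note `Real.log 0 = 0`, so `phiKL 0 = 1` as required. -/
def phiKL (s : ℝ) : ℝ := s * Real.log s - s + 1

/-- Kullback–Leibler divergence `KL(ρ|σ) = ∫ φ(dρ/dσ) dσ` if `ρ ≪ σ`, and `+∞` otherwise. -/
def KL {Z : Type*} [MeasurableSpace Z] (ρ σ : Measure Z) : ℝ≥0∞ :=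
  letI := Classical.propDecidable (ρ ≪ σ)
  if ρ ≪ σ then ∫⁻ z, ENNReal.ofReal (phiKL ((ρ.rnDeriv σ) z).toReal) ∂σ else ⊤

/-- The entropic optimal transport objective `⟨c,π⟩ + ε·KL(π|μ⊗ν)`, valued in `EReal`. -/
def EOT {X Y : Type*} [MeasurableSpace X] [MeasurableSpace Y]
    (c : X × Y → ℝ) (ε : ℝ) (μ : Measure X) (ν : Measure Y)
    (π : Measure (X × Y)) : EReal :=
  ((∫ p, c p ∂π : ℝ) : EReal) + (ε : EReal) * ((KL π (μ.prod ν) : ℝ≥0∞) : EReal)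


open InformationTheory in
lemma phiKL_nonneg {s : ℝ} (hs : 0 ≤ s) : 0 ≤ phiKL s := by
  have := klFun_nonneg hs
  rw [klFun_apply] at this
  unfold phiKL
  linarith

lemma measurable_phiKL : Measurable phiKL := by
  unfold phiKL
  fun_prop

lemma phiKL_exp (t : ℝ) : phiKL (Real.exp t) = Real.exp t * t - Real.exp t + 1 := by
  simp [phiKL]

/-- The Fenchel–Young inequality for `phiKL`. -/
lemma mul_sub_exp_add_one_le_phiKL {s : ℝ} (hs : 0 ≤ s) (t : ℝ) :
    s * t - Real.exp t + 1 ≤ phiKL s := by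
  unfold phiKL
  rcases hs.eq_or_lt with rfl | hs
  · simp [Real.exp_nonneg]
  · have h := Real.add_one_le_exp (t - Real.log s)
    rw [Real.exp_sub, Real.exp_log hs, le_div_iff₀ hs] at h
    linarith

section KL

variable {Z : Type*} [MeasurableSpace Z] {ρ σ : Measure Z}

lemma KL_of_ac (h : ρ ≪ σ) :
    KL ρ σ = ∫⁻ z, ENNReal.ofReal (phiKL ((ρ.rnDeriv σ) z).toReal) ∂σ := by
  simp [KL, h]

lemma absolutelyContinuous_of_KL_ne_top (h : KL ρ σ ≠ ⊤) : ρ ≪ σ := by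
  by_contra hac
  simp [KL, hac] at h

variable {f : Z → ℝ}

/-- The density of a Gibbs probability measure is integrable, with integral one. -/
lemma integrable_exp_and_integral_exp_eq_one [IsProbabilityMeasure ρ] (hfm : Measurable f)
    (hρ : ρ = σ.withDensity fun z => ENNReal.ofReal (Real.exp (f z))) :
    Integrable (fun z => Real.exp (f z)) σ ∧ ∫ z, Real.exp (f z) ∂σ = 1 := by
  have hmass : ∫⁻ z, ENNReal.ofReal (Real.exp (f z)) ∂σ = 1 := by
    rw [← setLIntegral_univ, ← withDensity_apply _ MeasurableSet.univ, ← hρ, measure_univ]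
  have hmeas : AEStronglyMeasurable (fun z => Real.exp (f z)) σ :=
    hfm.exp.aestronglyMeasurable
  have hnonneg : 0 ≤ᵐ[σ] fun z => Real.exp (f z) := ae_of_all _ fun z => Real.exp_nonneg _
  refine ⟨(lintegral_ofReal_ne_top_iff_integrable hmeas hnonneg).1 (by simp [hmass]), ?_⟩
  rw [integral_eq_lintegral_of_nonneg_ae hnonneg hmeas, hmass, ENNReal.toReal_one]

variable [IsProbabilityMeasure ρ] [IsProbabilityMeasure σ]

lemma integrable_rnDeriv_mul_sub_exp_add_one (hac : ρ ≪ σ) (hf : Integrable f ρ)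
    (hexp : Integrable (fun z => Real.exp (f z)) σ) :
    Integrable (fun z => (ρ.rnDeriv σ z).toReal * f z - Real.exp (f z) + 1) σ :=
  (((integrable_rnDeriv_smul_iff hac).2 hf).sub hexp).add (integrable_const 1)

lemma integral_rnDeriv_mul_sub_exp_add_one (hac : ρ ≪ σ) (hf : Integrable f ρ)
    (hexp : Integrable (fun z => Real.exp (f z)) σ) (hone : ∫ z, Real.exp (f z) ∂σ = 1) :
    ∫ z, ((ρ.rnDeriv σ z).toReal * f z - Real.exp (f z) + 1) ∂σ = ∫ z, f z ∂ρ := by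
  have hmul : Integrable (fun z => (ρ.rnDeriv σ z).toReal * f z) σ :=
    (integrable_rnDeriv_smul_iff hac).2 hf
  have hint : ∫ z, (ρ.rnDeriv σ z).toReal * f z ∂σ = ∫ z, f z ∂ρ := integral_rnDeriv_smul hac
  have hsub : Integrable (fun z => (ρ.rnDeriv σ z).toReal * f z - Real.exp (f z)) σ :=
    hmul.sub hexp
  rw [integral_add hsub (integrable_const 1), integral_sub hmul hexp, hint, hone]
  simp

/-- A lower bound on `KL` by duality. -/
lemma integral_le_toReal_KL (hKL : KL ρ σ ≠ ⊤) (hf : Integrable f ρ)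
    (hexp : Integrable (fun z => Real.exp (f z)) σ) (hone : ∫ z, Real.exp (f z) ∂σ = 1) :
    ∫ z, f z ∂ρ ≤ (KL ρ σ).toReal := by
  have hac := absolutelyContinuous_of_KL_ne_top hKL
  have hmeas : Measurable (fun z => phiKL (ρ.rnDeriv σ z).toReal) :=
    measurable_phiKL.comp (ρ.measurable_rnDeriv σ).ennreal_toReal
  have hnonneg : 0 ≤ᵐ[σ] fun z => phiKL (ρ.rnDeriv σ z).toReal :=
    ae_of_all _ fun z => phiKL_nonneg ENNReal.toReal_nonneg
  rw [KL_of_ac hac] at hKL ⊢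
  have hint : Integrable (fun z => phiKL (ρ.rnDeriv σ z).toReal) σ :=
    (lintegral_ofReal_ne_top_iff_integrable hmeas.aestronglyMeasurable hnonneg).1 hKL
  rw [← integral_eq_lintegral_of_nonneg_ae hnonneg hmeas.aestronglyMeasurable,
    ← integral_rnDeriv_mul_sub_exp_add_one hac hf hexp hone]
  exact integral_mono (integrable_rnDeriv_mul_sub_exp_add_one hac hf hexp) hint
    fun z => mul_sub_exp_add_one_le_phiKL ENNReal.toReal_nonneg (f z)

/-- The divergence of a Gibbs measure is the integral of its log-density. -/
lemma toReal_KL_of_eq_withDensity_exp (hfm : Measurable f)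
    (hρ : ρ = σ.withDensity fun z => ENNReal.ofReal (Real.exp (f z))) (hf : Integrable f ρ)
    (hexp : Integrable (fun z => Real.exp (f z)) σ) (hone : ∫ z, Real.exp (f z) ∂σ = 1) :
    KL ρ σ ≠ ⊤ ∧ (KL ρ σ).toReal = ∫ z, f z ∂ρ := by
  have hac : ρ ≪ σ := hρ ▸ withDensity_absolutelyContinuous _ _
  have hderiv : ρ.rnDeriv σ =ᵐ[σ] fun z => ENNReal.ofReal (Real.exp (f z)) := by
    rw [hρ]
    exact Measure.rnDeriv_withDensity σ (by fun_prop)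
  have heq : ∀ᵐ z ∂σ, phiKL (ρ.rnDeriv σ z).toReal =
      (ρ.rnDeriv σ z).toReal * f z - Real.exp (f z) + 1 := by
    filter_upwards [hderiv] with z hz
    rw [hz, ENNReal.toReal_ofReal (Real.exp_nonneg _), phiKL_exp]
  have hnonneg : 0 ≤ᵐ[σ] fun z => (ρ.rnDeriv σ z).toReal * f z - Real.exp (f z) + 1 := by
    filter_upwards [heq] with z hz
    rw [← hz]
    exact phiKL_nonneg ENNReal.toReal_nonneg
  rw [KL_of_ac hac, lintegral_congr_ae (heq.mono fun z hz => congrArg ENNReal.ofReal hz),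
    ← ofReal_integral_eq_lintegral_ofReal
      (integrable_rnDeriv_mul_sub_exp_add_one hac hf hexp) hnonneg]
  refine ⟨ENNReal.ofReal_ne_top, ?_⟩
  rw [ENNReal.toReal_ofReal (integral_nonneg_of_ae hnonneg),
    integral_rnDeriv_mul_sub_exp_add_one hac hf hexp hone]

end KL

section Coupling

variable {X Y : Type*} [MeasurableSpace X] [MeasurableSpace Y]
  {μ : Measure X} {ν : Measure Y} {π : Measure (X × Y)} {a : X → ℝ} {b : Y → ℝ} {c : X × Y → ℝ}

lemma IsCoupling.isProbabilityMeasure [IsProbabilityMeasure μ] (h : IsCoupling μ ν π) :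
    IsProbabilityMeasure π := by
  constructor
  rw [← Set.preimage_univ (f := Prod.fst), ← Measure.map_apply measurable_fst MeasurableSet.univ,
    h.1, measure_univ]

lemma IsCoupling.integrable_comp_fst (h : IsCoupling μ ν π) (ha : Integrable a μ) :
    Integrable (fun p : X × Y => a p.1) π := by
  rw [← h.1] at ha
  exact ha.comp_measurable measurable_fst

lemma IsCoupling.integrable_comp_snd (h : IsCoupling μ ν π) (hb : Integrable b ν) :
    Integrable (fun p : X × Y => b p.2) π := by
  rw [← h.2] at hb
  exact hb.comp_measurable measurable_snd

lemma IsCoupling.integral_comp_fst (h : IsCoupling μ ν π) (ha : AEStronglyMeasurable a μ) :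
    ∫ p, a p.1 ∂π = ∫ x, a x ∂μ := by
  rw [← h.1] at ha ⊢
  exact (integral_map measurable_fst.aemeasurable ha).symm

lemma IsCoupling.integral_comp_snd (h : IsCoupling μ ν π) (hb : AEStronglyMeasurable b ν) :
    ∫ p, b p.2 ∂π = ∫ y, b y ∂ν := by
  rw [← h.2] at hb ⊢
  exact (integral_map measurable_snd.aemeasurable hb).symm

lemma IsCoupling.integrable_potential (h : IsCoupling μ ν π) (ha : Integrable a μ)
    (hb : Integrable b ν) (hc : Integrable c π) (ε : ℝ) :
    Integrable (fun p => (a p.1 + b p.2 - c p) / ε) π :=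
  (((h.integrable_comp_fst ha).add (h.integrable_comp_snd hb)).sub hc).div_const ε

/-- The cost plus the scaled integral of the potential does not depend on the coupling. -/
lemma IsCoupling.integral_add_mul_integral_potential (h : IsCoupling μ ν π) (ha : Integrable a μ)
    (hb : Integrable b ν) (hc : Integrable c π) {ε : ℝ} (hε : ε ≠ 0) :
    ∫ p, c p ∂π + ε * ∫ p, (a p.1 + b p.2 - c p) / ε ∂π = ∫ x, a x ∂μ + ∫ y, b y ∂ν := by
  have ha' := h.integrable_comp_fst ha
  have hb' := h.integrable_comp_snd hb
  have hab : Integrable (fun p : X × Y => a p.1 + b p.2) π := ha'.add hb'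
  rw [integral_div, integral_sub hab hc, integral_add ha' hb',
    h.integral_comp_fst ha.aestronglyMeasurable, h.integral_comp_snd hb.aestronglyMeasurable]
  field_simp
  ring

lemma EOT_eq_coe {ε : ℝ} (h : KL π (μ.prod ν) ≠ ⊤) :
    EOT c ε μ ν π = ((∫ p, c p ∂π + ε * (KL π (μ.prod ν)).toReal : ℝ) : EReal) := by
  rw [EOT, EReal.coe_add, EReal.coe_mul, EReal.coe_ennreal_toReal h]

lemma EOT_eq_top {ε : ℝ} (hε : 0 < ε) (h : KL π (μ.prod ν) = ⊤) : EOT c ε μ ν π = ⊤ := by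
  rw [EOT, h, EReal.coe_ennreal_top, EReal.coe_mul_top_of_pos hε, EReal.coe_add_top]

end Coupling

/-- a coupling of the form `exp((α⊕β−c)/ε)·(μ⊗ν)` with `α ∈ L^∞(μ)`,
`β ∈ L^∞(ν)` is optimal for the entropic optimal transport problem. -/
theorem entropic_OT_potential_form_is_optimal
    {X Y : Type*} [MetricSpace X] [CompactSpace X] [MeasurableSpace X] [BorelSpace X]
    [MetricSpace Y] [CompactSpace Y] [MeasurableSpace Y] [BorelSpace Y]
    (μ : Measure X) (ν : Measure Y) [IsProbabilityMeasure μ] [IsProbabilityMeasure ν]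
    (c : X × Y → ℝ) (hc_lsc : LowerSemicontinuous c) (hc_nonneg : ∀ p, 0 ≤ c p)
    (M : ℝ) (hc_bdd : ∀ p, c p ≤ M) (ε : ℝ) (hε : 0 < ε)
    (πstar : Measure (X × Y)) (hπstar : IsCoupling μ ν πstar)
    (αstar : X → ℝ) (βstar : Y → ℝ) (hα : Measurable αstar) (hβ : Measurable βstar)
    (hα_bdd : ∃ K : ℝ, ∀ᵐ x ∂μ, |αstar x| ≤ K)
    (hβ_bdd : ∃ K : ℝ, ∀ᵐ y ∂ν, |βstar y| ≤ K)
    (hform : πstar = (μ.prod ν).withDensity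
      (fun p => ENNReal.ofReal (Real.exp ((αstar p.1 + βstar p.2 - c p) / ε)))) :
    ∀ π : Measure (X × Y), IsCoupling μ ν π →
      EOT c ε μ ν πstar ≤ EOT c ε μ ν π := by
  intro π hπ
  have := hπstar.isProbabilityMeasure
  have := hπ.isProbabilityMeasure
  obtain ⟨K, hK⟩ := hα_bdd
  obtain ⟨L, hL⟩ := hβ_bdd
  have hcm : Measurable c := hc_lsc.measurable
  have hαi : Integrable αstar μ := .of_bound hα.aestronglyMeasurable K hK
  have hβi : Integrable βstar ν := .of_bound hβ.aestronglyMeasurable L hL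
  have hci (ρ : Measure (X × Y)) [IsProbabilityMeasure ρ] : Integrable c ρ :=
    .of_bound hcm.aestronglyMeasurable M (ae_of_all _ fun p => by
      rw [Real.norm_of_nonneg (hc_nonneg p)]
      exact hc_bdd p)
  have hfm : Measurable fun p : X × Y => (αstar p.1 + βstar p.2 - c p) / ε := by fun_prop
  have hfstar := hπstar.integrable_potential hαi hβi (hci πstar) ε
  have hf := hπ.integrable_potential hαi hβi (hci π) ε
  obtain ⟨hexp, hone⟩ := integrable_exp_and_integral_exp_eq_one hfm hform
  obtain ⟨hKLstar_ne_top, hKLstar⟩ :=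
    toReal_KL_of_eq_withDensity_exp hfm hform hfstar hexp hone
  by_cases hKL : KL π (μ.prod ν) = ⊤
  · rw [EOT_eq_top hε hKL]
    exact le_top
  rw [EOT_eq_coe hKLstar_ne_top, EOT_eq_coe hKL, EReal.coe_le_coe_iff, hKLstar,
    hπstar.integral_add_mul_integral_potential hαi hβi (hci πstar) hε.ne',
    ← hπ.integral_add_mul_integral_potential hαi hβi (hci π) hε.ne']
  gcongr
  exact integral_le_toReal_KL hKL hf hexp hone
end
end

section
/- Let π̂ be a flow update of π with gluing edge candidates, i.e. π̂ := Σ_{j∈I} Σ_{i∈𝒩(j)} w*_{ij}·π̂_{ij} where w* minimizes Σ_{(i,j)∈𝒩} w_{ij}·⟨c, π̂_{ij} − π̂_{ii}⟩ over mass-preserving flows, the π̂_{ij} (i≠j) are gluing edge candidates, and π̂_{ii} = π_i/m_i. Then π̂ ∈ Π(μ,ν) (the flow update preserves the marginals) and the entropic optimal transport objective does not increase: ⟨c, π̂⟩ + ε·KL(π̂ | μ⊗ν) ≤ ⟨c, π⟩ + ε·KL(π | μ⊗ν). -/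
open MeasureTheory Filter Topology
open scoped ENNReal

noncomputable section

/-- The family of gluing edge candidates: `π̂_{ii} = π_i/m_i` on the diagonal, and for `i ≠ j`
the gluing candidate `π̂_{ij}(A×B) = (1/m_i) ∫_{X_i} (γ_{ij})_x(A)·(π_i)_x(B) dμ_i(x)`,
formalized via `Measure.bind` over the disintegration kernels `γk i j` and `πk i`. -/
def gluingPihat {X Y : Type*} [MeasurableSpace X] [MeasurableSpace Y]
    {I : Type*} [DecidableEq I]
    (μ : Measure X) (π : Measure (X × Y)) (Xpart : I → Set X)
    (γk : I → I → X → Measure X) (πk : I → X → Measure Y) (i j : I) : Measure (X × Y) :=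
  if i = j then (μ (Xpart i))⁻¹ • π.restrict (Xpart i ×ˢ Set.univ)
  else (μ (Xpart i))⁻¹ • (μ.restrict (Xpart i)).bind (fun x => (γk i j x).prod (πk i x))

open ProbabilityTheory InformationTheory

lemma KL_eq_klDiv {Z : Type*} [MeasurableSpace Z] (ρ σ : Measure Z)
    [IsFiniteMeasure ρ] [IsFiniteMeasure σ] : KL ρ σ = klDiv ρ σ := by
  have h : ∀ s, phiKL s = klFun s := fun s => by unfold phiKL klFun; ring
  rw [klDiv_eq_lintegral_klFun, KL]
  simp_rw [h]

lemma exists_measurable_index_of_iUnion_eq_univ {Z I : Type*} [MeasurableSpace Z] [Nonempty Z]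
    [Countable I] {s : I → Set Z} (hs : ∀ i, MeasurableSet (s i)) (hcover : ⋃ i, s i = Set.univ) :
    ∃ ι : Z → I, (∀ i, MeasurableSet (ι ⁻¹' {i})) ∧ ∀ z, z ∈ s (ι z) := by
  classical
  have hex : ∀ z, ∃ i, z ∈ s i := fun z => by
    simpa using (hcover ▸ Set.mem_univ z : z ∈ ⋃ i, s i)
  have : Nonempty I := ⟨(hex (Classical.arbitrary Z)).choose⟩
  obtain ⟨f, hf⟩ := exists_surjective_nat I
  have hN : ∀ z, ∃ n, z ∈ s (f n) := fun z => by
    obtain ⟨i, hi⟩ := hex z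
    obtain ⟨n, rfl⟩ := hf i
    exact ⟨n, hi⟩
  refine ⟨fun z => f (Nat.find (hN z)), fun i => ?_, fun z => Nat.find_spec (hN z)⟩
  exact measurable_find hN (fun n => hs (f n)) (MeasurableSet.of_discrete (s := f ⁻¹' {i}))

/-- The finite mixture `z ↦ ∑ e, w e • 1_{D e}(z) • κ e z` of the kernels `κ e`. -/
def mixKernel {Z W J : Type*} [MeasurableSpace Z] [MeasurableSpace W] [Fintype J]
    (D : J → Set Z) (hD : ∀ e, MeasurableSet (D e)) (w : J → ℝ≥0∞) (κ : J → Kernel Z W) :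
    Kernel Z W where
  toFun z := ∑ e, (D e).indicator (fun _ => w e) z • κ e z
  measurable' := by
    refine Measure.measurable_of_measurable_coe _ fun s hs => ?_
    simp only [Measure.coe_finsetSum, Finset.sum_apply, Measure.smul_apply, smul_eq_mul]
    exact Finset.measurable_sum _ fun e _ =>
      (measurable_const.indicator (hD e)).mul ((κ e).measurable_coe hs)

section mixKernel

variable {Z W Y J : Type*} [MeasurableSpace Z] [MeasurableSpace W] [MeasurableSpace Y] [Fintype J]
  {D : J → Set Z} (hD : ∀ e, MeasurableSet (D e)) (w : J → ℝ≥0∞) (κ : J → Kernel Z W)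

lemma mixKernel_apply (z : Z) :
    mixKernel D hD w κ z = ∑ e, (D e).indicator (fun _ => w e) z • κ e z := rfl

lemma mixKernel_comp (ρ : Measure Z) :
    mixKernel D hD w κ ∘ₘ ρ = ∑ e, w e • (κ e ∘ₘ ρ.restrict (D e)) := by
  ext s hs
  rw [Measure.bind_apply hs (Kernel.aemeasurable _)]
  simp only [mixKernel_apply, Measure.coe_finsetSum, Finset.sum_apply, Measure.smul_apply,
    smul_eq_mul]
  have hmeas : ∀ e, Measurable fun z => (D e).indicator (fun _ => w e) z * κ e z s := fun e =>
    (measurable_const.indicator (hD e)).mul ((κ e).measurable_coe hs)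
  rw [lintegral_finsetSum _ fun e _ => hmeas e]
  refine Finset.sum_congr rfl fun e _ => ?_
  rw [Measure.bind_apply hs (Kernel.aemeasurable _),
    ← lintegral_const_mul _ ((κ e).measurable_coe hs), ← lintegral_indicator (hD e)]
  refine lintegral_congr fun z => ?_
  by_cases hz : z ∈ D e <;> simp [hz]

lemma isMarkovKernel_mixKernel [∀ e, IsMarkovKernel (κ e)]
    (h : ∀ z, ∑ e, (D e).indicator (fun _ => w e) z = 1) :
    IsMarkovKernel (mixKernel D hD w κ) :=
  ⟨fun z => ⟨by simp [mixKernel_apply, h]⟩⟩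

lemma mixKernel_parallelComp_id [∀ e, IsMarkovKernel (κ e)]
    [IsMarkovKernel (mixKernel D hD w κ)] :
    mixKernel D hD w κ ∥ₖ (Kernel.id : Kernel Y Y)
      = mixKernel (fun e => Prod.fst ⁻¹' D e) (fun e => measurable_fst (hD e)) w
          (fun e => κ e ∥ₖ (Kernel.id : Kernel Y Y)) := by
  ext p s hs
  have hf : Measurable fun x : W => (x, p.2) := by fun_prop
  rw [Kernel.parallelComp_apply, Kernel.id_apply, Measure.prod_dirac, Measure.map_apply hf hs]
  simp only [mixKernel_apply, Kernel.parallelComp_apply, Kernel.id_apply, Measure.prod_dirac,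
    Measure.coe_finsetSum, Finset.sum_apply, Measure.smul_apply, smul_eq_mul,
    Measure.map_apply hf hs]
  rfl

end mixKernel

lemma IsCoupling.parallelComp_id_comp {X Y : Type*} [MeasurableSpace X] [MeasurableSpace Y]
    {μ : Measure X} {ν : Measure Y} {π : Measure (X × Y)} (hπ : IsCoupling μ ν π)
    (κ : Kernel X X) [IsMarkovKernel κ] (hκ : κ ∘ₘ μ = μ) :
    IsCoupling μ ν ((κ ∥ₖ (Kernel.id : Kernel Y Y)) ∘ₘ π) := by
  constructor
  · have h : (κ ∥ₖ (Kernel.id : Kernel Y Y)).map Prod.fst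
        = κ ∘ₖ Kernel.deterministic Prod.fst measurable_fst := by
      ext p : 1
      rw [Kernel.map_apply _ measurable_fst, Kernel.parallelComp_apply,
        Kernel.comp_deterministic_eq_comap, Kernel.comap_apply, ← Measure.fst, Measure.fst_prod]
    rw [Measure.map_comp _ _ measurable_fst, h, ← Measure.comp_assoc,
      Measure.deterministic_comp_eq_map, hπ.1, hκ]
  · have h : (κ ∥ₖ (Kernel.id : Kernel Y Y)).map Prod.snd
        = Kernel.deterministic Prod.snd measurable_snd := by
      ext p : 1
      rw [Kernel.map_apply _ measurable_snd, Kernel.parallelComp_apply,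
        Kernel.deterministic_apply, ← Measure.snd, Measure.snd_prod, Kernel.id_apply]
    rw [Measure.map_comp _ _ measurable_snd, h, Measure.deterministic_comp_eq_map, hπ.2]

lemma KL_parallelComp_id_comp_le {X Y : Type*} [MeasurableSpace X] [MeasurableSpace Y]
    (μ : Measure X) (ν : Measure Y) (π : Measure (X × Y)) [IsFiniteMeasure μ] [IsFiniteMeasure ν]
    [IsFiniteMeasure π] (κ : Kernel X X) [IsMarkovKernel κ] (hκ : κ ∘ₘ μ = μ) :
    KL ((κ ∥ₖ (Kernel.id : Kernel Y Y)) ∘ₘ π) (μ.prod ν) ≤ KL π (μ.prod ν) := by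
  have h : (κ ∥ₖ (Kernel.id : Kernel Y Y)) ∘ₘ (μ.prod ν) = μ.prod ν := by
    rw [← Measure.prod_comp_left, hκ]
  rw [KL_eq_klDiv, KL_eq_klDiv]
  conv_lhs => rw [← h]
  exact klDiv_comp_right_le _ _ _

lemma sum_restrict_eq_of_iUnion_eq_univ {Z I : Type*} [MeasurableSpace Z] [Fintype I]
    (ρ : Measure Z) {s : I → Set Z} (hs : ∀ i, MeasurableSet (s i))
    (hcover : ⋃ i, s i = Set.univ) (hdisj : ∀ i j, i ≠ j → ρ (s i ∩ s j) = 0) :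
    ∑ i, ρ.restrict (s i) = ρ := by
  conv_rhs => rw [← Measure.restrict_univ (μ := ρ), ← hcover,
    Measure.restrict_iUnion_ae (fun i j h => hdisj i j h) fun i => (hs i).nullMeasurableSet]
  rw [Measure.sum_fintype]

/-- The kernels by which the edges of the neighborhood graph move mass in the first factor. -/
def edgeKernel {X I : Type*} [MeasurableSpace X] [DecidableEq I] (γk : I → I → X → Measure X)
    (hγk_meas : ∀ i j, Measurable (γk i j)) (e : I × I) : Kernel X X :=
  if e.1 = e.2 then Kernel.id else ⟨γk e.1 e.2, hγk_meas e.1 e.2⟩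

lemma isMarkovKernel_edgeKernel {X I : Type*} [MeasurableSpace X] [DecidableEq I]
    {γk : I → I → X → Measure X} (hγk_meas : ∀ i j, Measurable (γk i j))
    (hγk_prob : ∀ i j x, IsProbabilityMeasure (γk i j x)) (e : I × I) :
    IsMarkovKernel (edgeKernel γk hγk_meas e) := by
  unfold edgeKernel
  split_ifs
  · infer_instance
  · exact ⟨fun x => hγk_prob _ _ x⟩

lemma gluingPihat_eq_comp {X Y I : Type*} [MeasurableSpace X] [MeasurableSpace Y] [DecidableEq I]
    (μ : Measure X) (π : Measure (X × Y)) (Xpart : I → Set X)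
    {γk : I → I → X → Measure X} (hγk_meas : ∀ i j, Measurable (γk i j))
    (hγk_prob : ∀ i j x, IsProbabilityMeasure (γk i j x))
    {πk : I → X → Measure Y} (hπk_meas : ∀ i, Measurable (πk i))
    (hπk_prob : ∀ i x, IsProbabilityMeasure (πk i x))
    (hπ_disint : ∀ i, π.restrict (Xpart i ×ˢ Set.univ)
      = (μ.restrict (Xpart i)).bind (fun x => (Measure.dirac x).prod (πk i x))) (e : I × I) :
    gluingPihat μ π Xpart γk πk e.1 e.2 = (μ (Xpart e.1))⁻¹ •
      ((edgeKernel γk hγk_meas e ∥ₖ (Kernel.id : Kernel Y Y)) ∘ₘ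
        π.restrict (Xpart e.1 ×ˢ Set.univ)) := by
  unfold gluingPihat edgeKernel
  split_ifs with h
  · rw [Kernel.id_parallelComp_id, Measure.id_comp]
  · let η : Kernel X X := ⟨γk e.1 e.2, hγk_meas e.1 e.2⟩
    let θ : Kernel X Y := ⟨πk e.1, hπk_meas e.1⟩
    have : IsMarkovKernel η := ⟨fun x => hγk_prob _ _ x⟩
    have : IsMarkovKernel θ := ⟨fun x => hπk_prob _ x⟩
    have h1 : π.restrict (Xpart e.1 ×ˢ Set.univ)
        = (Kernel.id ×ₖ θ) ∘ₘ μ.restrict (Xpart e.1) := by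
      rw [hπ_disint]
      congr 1
      ext x : 1
      rw [Kernel.prod_apply, Kernel.id_apply]
      rfl
    change _ = _ • ((η ∥ₖ Kernel.id) ∘ₘ _)
    rw [h1, Measure.comp_assoc, Kernel.parallelComp_comp_prod, Kernel.comp_id, Kernel.id_comp]
    congr 2
    ext x : 1
    rw [Kernel.prod_apply]
    rfl

lemma edgeKernel_comp_restrict {X I : Type*} [MeasurableSpace X] [DecidableEq I]
    (μ : Measure X) {Xpart : I → Set X}
    {γk : I → I → X → Measure X} (hγk_meas : ∀ i j, Measurable (γk i j))
    (hγk_prob : ∀ i j x, IsProbabilityMeasure (γk i j x)) (e : I × I)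
    (hγ_marg : e.1 ≠ e.2 →
      (((μ (Xpart e.1))⁻¹ • μ.restrict (Xpart e.1)).bind
          (fun x => (Measure.dirac x).prod (γk e.1 e.2 x))).map Prod.snd
        = (μ (Xpart e.2))⁻¹ • μ.restrict (Xpart e.2)) :
    (μ (Xpart e.1))⁻¹ • (edgeKernel γk hγk_meas e ∘ₘ μ.restrict (Xpart e.1))
      = (μ (Xpart e.2))⁻¹ • μ.restrict (Xpart e.2) := by
  unfold edgeKernel
  split_ifs with h
  · rw [Measure.id_comp, h]
  · let η : Kernel X X := ⟨γk e.1 e.2, hγk_meas e.1 e.2⟩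
    have : IsMarkovKernel η := ⟨fun x => hγk_prob _ _ x⟩
    rw [← hγ_marg h]
    have h1 : (fun x => (Measure.dirac x).prod (γk e.1 e.2 x))
        = ((Kernel.id ×ₖ η : Kernel X (X × X)) : X → Measure (X × X)) := by
      ext x : 1
      rw [Kernel.prod_apply, Kernel.id_apply]
      rfl
    rw [h1, Measure.map_comp _ _ measurable_snd, ← Kernel.snd_eq, Kernel.snd_prod,
      Measure.comp_smul]

/-- a flow update with gluing edge candidates (with an optimal mass-preserving
flow `w*` for the min-cost flow problem) preserves the marginals and does not increase the
entropic optimal transport objective. -/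
theorem flow_update_preserves_marginals_and_score
    {X Y : Type*} [MetricSpace X] [CompactSpace X] [MeasurableSpace X] [BorelSpace X]
    [MetricSpace Y] [CompactSpace Y] [MeasurableSpace Y] [BorelSpace Y]
    {I : Type*} [Fintype I] [DecidableEq I]
    (μ : Measure X) (ν : Measure Y) [IsProbabilityMeasure μ] [IsProbabilityMeasure ν]
    (c : X × Y → ℝ) (hc_meas : Measurable c) (M : ℝ) (hc_bdd : ∀ p, |c p| ≤ M)
    (ε : ℝ) (hε : 0 < ε)
    (π : Measure (X × Y)) (hπ : IsCoupling μ ν π)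
    (Xpart : I → Set X) (hclosed : ∀ i, IsClosed (Xpart i))
    (hcover : ⋃ i, Xpart i = Set.univ)
    (hdisj : ∀ i j, i ≠ j → μ (Xpart i ∩ Xpart j) = 0)
    (hm : ∀ i, 0 < μ (Xpart i))
    (N : Finset (I × I)) (hNrefl : ∀ i, (i, i) ∈ N)
    (hNsymm : ∀ i j, (i, j) ∈ N → (j, i) ∈ N)
    -- disintegration kernels of the couplings γ_{ij} ∈ Π(μ_i/m_i, μ_j/m_j)
    (γk : I → I → X → Measure X) (hγk_meas : ∀ i j, Measurable (γk i j))
    (hγk_prob : ∀ i j x, IsProbabilityMeasure (γk i j x))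
    (hγ_marg : ∀ i j, (i, j) ∈ N → i ≠ j →
      (((μ (Xpart i))⁻¹ • μ.restrict (Xpart i)).bind
          (fun x => (Measure.dirac x).prod (γk i j x))).map Prod.snd
        = (μ (Xpart j))⁻¹ • μ.restrict (Xpart j))
    -- disintegration kernels of the cell plans π_i with respect to μ_i
    (πk : I → X → Measure Y) (hπk_meas : ∀ i, Measurable (πk i))
    (hπk_prob : ∀ i x, IsProbabilityMeasure (πk i x))
    (hπ_disint : ∀ i, π.restrict (Xpart i ×ˢ Set.univ)
      = (μ.restrict (Xpart i)).bind (fun x => (Measure.dirac x).prod (πk i x)))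
    -- `wstar` is a mass-preserving flow minimizing the min-cost flow objective
    (wstar : I → I → ℝ) (hw_nonneg : ∀ i j, 0 ≤ wstar i j)
    (hw_supp : ∀ i j, (i, j) ∉ N → wstar i j = 0)
    (hdiv_out : ∀ i, ∑ j, wstar i j = (μ (Xpart i)).toReal)
    (hdiv_in : ∀ i, ∑ j, wstar j i = (μ (Xpart i)).toReal)
    (hopt : ∀ w' : I → I → ℝ, (∀ i j, 0 ≤ w' i j) → (∀ i j, (i, j) ∉ N → w' i j = 0) →
      (∀ i, ∑ j, w' i j = (μ (Xpart i)).toReal) →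
      (∀ i, ∑ j, w' j i = (μ (Xpart i)).toReal) →
      ∑ e ∈ N, wstar e.1 e.2 *
          ((∫ p, c p ∂(gluingPihat μ π Xpart γk πk e.1 e.2)) -
            ∫ p, c p ∂(gluingPihat μ π Xpart γk πk e.1 e.1)) ≤
        ∑ e ∈ N, w' e.1 e.2 *
          ((∫ p, c p ∂(gluingPihat μ π Xpart γk πk e.1 e.2)) -
            ∫ p, c p ∂(gluingPihat μ π Xpart γk πk e.1 e.1))) :
    IsCoupling μ ν
      (∑ e ∈ N, ENNReal.ofReal (wstar e.1 e.2) • gluingPihat μ π Xpart γk πk e.1 e.2) ∧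
    EOT c ε μ ν
        (∑ e ∈ N, ENNReal.ofReal (wstar e.1 e.2) • gluingPihat μ π Xpart γk πk e.1 e.2)
      ≤ EOT c ε μ ν π := by
  have hXm : ∀ i, MeasurableSet (Xpart i) := fun i => (hclosed i).measurableSet
  have : IsProbabilityMeasure π := ⟨by
    rw [← Set.preimage_univ (f := Prod.fst), ← Measure.map_apply measurable_fst .univ, hπ.1,
      measure_univ]⟩
  have hfst : MeasurePreserving Prod.fst π μ := ⟨measurable_fst, hπ.1⟩
  have : Nonempty X := μ.nonempty_of_neZero
  obtain ⟨ι, hι, hmem⟩ := exists_measurable_index_of_iUnion_eq_univ hXm hcover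
  have hae : ∀ i, ι ⁻¹' {i} =ᵐ[μ] Xpart i := by
    intro i
    have hnull : ∀ᵐ x ∂μ, ∀ k, i ≠ k → x ∉ Xpart i ∩ Xpart k :=
      ae_all_iff.2 fun k => by
        by_cases h : i = k
        · simp [h]
        · filter_upwards [measure_eq_zero_iff_ae_notMem.1 (hdisj i k h)] with x hx _ using hx
    filter_upwards [hnull] with x hx
    refine propext ⟨fun h => ?_, fun h => ?_⟩
    · have h' : ι x = i := h
      exact h' ▸ hmem x
    · by_contra h'
      exact hx (ι x) (fun h2 => h' h2.symm) ⟨h, hmem x⟩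
  have hm0 : ∀ i, μ (Xpart i) ≠ 0 := fun i => (hm i).ne'
  have hmt : ∀ i, μ (Xpart i) ≠ ∞ := fun i => measure_ne_top _ _
  have hEM := isMarkovKernel_edgeKernel hγk_meas hγk_prob
  set G := fun e : I × I => gluingPihat μ π Xpart γk πk e.1 e.2 with hG
  have hGe : ∀ e, G e = _ :=
    gluingPihat_eq_comp μ π Xpart hγk_meas hγk_prob hπk_meas hπk_prob hπ_disint
  -- The flow update is the image of `π` under a Markov kernel acting on the first factor.
  set Θ : Kernel X X := mixKernel (fun e : I × I => ι ⁻¹' {e.1}) (fun e => hι e.1)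
    (fun e => ENNReal.ofReal (wstar e.1 e.2) * (μ (Xpart e.1))⁻¹) (edgeKernel γk hγk_meas) with hΘ
  have hout : ∀ i, ∑ j, ENNReal.ofReal (wstar i j) = μ (Xpart i) := fun i => by
    rw [← ENNReal.ofReal_sum_of_nonneg fun j _ => hw_nonneg i j, hdiv_out,
      ENNReal.ofReal_toReal (hmt i)]
  have hin : ∀ i, ∑ j, ENNReal.ofReal (wstar j i) = μ (Xpart i) := fun i => by
    rw [← ENNReal.ofReal_sum_of_nonneg fun j _ => hw_nonneg j i, hdiv_in,
      ENNReal.ofReal_toReal (hmt i)]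
  have hΘM : IsMarkovKernel Θ := by
    refine isMarkovKernel_mixKernel _ _ _ fun x => ?_
    rw [Fintype.sum_prod_type, Finset.sum_eq_single (ι x)]
    · simp [← Finset.sum_mul, hout, ENNReal.mul_inv_cancel (hm0 _) (hmt _)]
    · intro i _ hi
      simp [hi.symm]
    · simp
  have hsumμ := sum_restrict_eq_of_iUnion_eq_univ μ hXm hcover hdisj
  have hΘμ : Θ ∘ₘ μ = μ := by
    rw [hΘ, mixKernel_comp]
    have hterm : ∀ e : I × I, (ENNReal.ofReal (wstar e.1 e.2) * (μ (Xpart e.1))⁻¹) •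
          (edgeKernel γk hγk_meas e ∘ₘ μ.restrict (ι ⁻¹' {e.1}))
        = (ENNReal.ofReal (wstar e.1 e.2) * (μ (Xpart e.2))⁻¹) • μ.restrict (Xpart e.2) := by
      intro e
      by_cases he : e ∈ N
      · rw [Measure.restrict_congr_set (hae e.1), mul_smul,
          edgeKernel_comp_restrict μ hγk_meas hγk_prob e (hγ_marg e.1 e.2 he), mul_smul]
      · simp [hw_supp e.1 e.2 he]
    simp_rw [hterm]
    rw [Fintype.sum_prod_type_right]
    conv_rhs => rw [← hsumμ]
    refine Finset.sum_congr rfl fun j _ => ?_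
    dsimp only
    rw [← Finset.sum_smul, ← Finset.sum_mul, hin, ENNReal.mul_inv_cancel (hm0 _) (hmt _), one_smul]
  have hupd : ∑ e ∈ N, ENNReal.ofReal (wstar e.1 e.2) • G e
      = (Θ ∥ₖ (Kernel.id : Kernel Y Y)) ∘ₘ π := by
    rw [hΘ, mixKernel_parallelComp_id, mixKernel_comp,
      Finset.sum_subset (Finset.subset_univ N) fun e _ he => by simp [hw_supp e.1 e.2 he]]
    refine Finset.sum_congr rfl fun e _ => ?_
    rw [hGe, mul_smul, Set.prod_univ,
      Measure.restrict_congr_set (hfst.quasiMeasurePreserving.preimage_ae_eq (hae e.1))]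
  have hc_int : ∀ (ρ : Measure (X × Y)) [IsFiniteMeasure ρ], Integrable c ρ := fun ρ _ =>
    Integrable.of_bound hc_meas.aestronglyMeasurable M (ae_of_all _ hc_bdd)
  have hGfin : ∀ e, IsFiniteMeasure (G e) := fun e => by
    rw [hGe]
    exact Measure.smul_finite _ (ENNReal.inv_ne_top.2 (hm0 _))
  have hdiag : ∑ i, (μ (Xpart i)).toReal * ∫ p, c p ∂(G (i, i)) = ∫ p, c p ∂π := by
    have hsumπ : ∑ i, π.restrict (Prod.fst ⁻¹' Xpart i) = π := by
      refine sum_restrict_eq_of_iUnion_eq_univ π (fun i => measurable_fst (hXm i)) ?_ ?_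
      · rw [← Set.preimage_iUnion, hcover, Set.preimage_univ]
      · intro i j hij
        rw [← Set.preimage_inter, hfst.measure_preimage
          ((hXm i).inter (hXm j)).nullMeasurableSet, hdisj i j hij]
    conv_rhs => rw [← hsumπ]
    rw [integral_finsetSum_measure fun i _ => hc_int _]
    refine Finset.sum_congr rfl fun i _ => ?_
    simp only [hG, gluingPihat, if_true]
    rw [integral_smul_measure, Set.prod_univ, smul_eq_mul, ENNReal.toReal_inv, ← mul_assoc,
      mul_inv_cancel₀ (ENNReal.toReal_ne_zero.2 ⟨hm0 i, hmt i⟩), one_mul]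
  have hcost : ∫ p, c p ∂(∑ e ∈ N, ENNReal.ofReal (wstar e.1 e.2) • G e) ≤ ∫ p, c p ∂π := by
    have hle := hopt (fun i j => if i = j then (μ (Xpart i)).toReal else 0)
      (fun i j => by split_ifs <;> simp)
      (fun i j hij => by
        have : i ≠ j := fun h => hij (h ▸ hNrefl i)
        simp [this])
      (fun i => by simp) (fun i => by simp)
    have hzero : ∀ e ∈ N, (if e.1 = e.2 then (μ (Xpart e.1)).toReal else 0) *
        ((∫ p, c p ∂(G e)) - ∫ p, c p ∂(G (e.1, e.1))) = 0 := by
      rintro ⟨i, j⟩ _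
      by_cases h : i = j
      · simp [h]
      · simp [h]
    rw [Finset.sum_eq_zero hzero] at hle
    have hsplit : ∑ e ∈ N, wstar e.1 e.2 * ∫ p, c p ∂(G (e.1, e.1)) = ∫ p, c p ∂π := by
      rw [Finset.sum_subset (Finset.subset_univ N) fun e _ he => by simp [hw_supp e.1 e.2 he],
        Fintype.sum_prod_type, ← hdiag]
      simp_rw [← Finset.sum_mul, hdiv_out]
    rw [integral_finsetSum_measure fun e _ =>
      (hc_int (G e)).smul_measure ENNReal.ofReal_ne_top]
    simp_rw [integral_smul_measure, ENNReal.toReal_ofReal (hw_nonneg _ _), smul_eq_mul]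
    simp_rw [mul_sub, Finset.sum_sub_distrib] at hle
    linarith
  refine ⟨?_, ?_⟩
  · rw [hupd]
    exact hπ.parallelComp_id_comp Θ hΘμ
  · refine add_le_add (EReal.coe_le_coe_iff.2 hcost) ?_
    refine mul_le_mul_of_nonneg_left (EReal.coe_ennreal_le_coe_ennreal_iff.2 ?_)
      (EReal.coe_nonneg.2 hε.le)
    rw [hupd]
    exact KL_parallelComp_id_comp_le μ ν π Θ hΘμ
end
end
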